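/- (Vicious walkers / Lindström–Gessel–Viennot formula.) Let P ≥ 1, t ∈ ℕ, and let x⁰, x : {1,…,P} → ℤ be strictly increasing. For a tuple ε = (ε_1,…,ε_P) of step functions ε_i : {1,…,t} → {0,1}, define walker positions X_i(s) := x⁰_i + Σ_{u=1}^{s} ε_i(u) and the weight w(ε) := ∏_{i=1}^P v^{Σ_{u=1}^t ε_i(u)}·(1−v)^{t−Σ_{u=1}^t ε_i(u)}. Then the sum of w(ε) over all tuples ε such that X_i(t) = x_i for every i and X_1(s) < X_2(s) < ⋯ < X_P(s) for every s ∈ {0,1,…,t} equals det[F₀(x_j − x⁰_i | t)]_{i,j=1,…,P}. -/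

import Mathlib

open Finset

namespace TASEP

attribute [local instance] Classical.propDecidable

noncomputable section

/-- Generalized binomial coefficient `C(n,k) = n(n-1)⋯(n-k+1)/k!` for `n : ℤ`, `k : ℕ`. -/
def C (n : ℤ) (k : ℕ) : ℝ :=
  (∏ i ∈ Finset.range k, ((n : ℝ) - (i : ℝ))) / (k.factorial : ℝ)

/-- `λ = v/(1-v)`. -/
def lam (v : ℝ) : ℝ := v / (1 - v)

/-- The matrix element `f(a,b,t)` of the determinant solution of the parallel TASEP. -/
def f (v : ℝ) (a b : ℤ) (t : ℕ) : ℝ :=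
  if 1 ≤ a then
    (1 - v) ^ t * (-1 : ℝ) ^ a *
      ∑' k : ℕ, if 0 ≤ b + (k : ℤ) then
        C ((t : ℤ) + a) (b + (k : ℤ)).toNat * C (a + (k : ℤ) - 1) k *
          lam v ^ (b + (k : ℤ)).toNat
      else 0
  else
    (1 - v) ^ t * (-1 : ℝ) ^ a *
      ∑' j : ℕ, if (j : ℤ) ≤ -a ∧ 0 ≤ b + (j : ℤ) then
        (-1 : ℝ) ^ j * C (-a) j * C ((t : ℤ) + a) (b + (j : ℤ)).toNat *
          lam v ^ (b + (j : ℤ)).toNat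
      else 0

/-- Number of pairs of neighboring particles (occupied neighboring sites) in `x`. -/
def nPairs {P : ℕ} (x : Fin P → ℤ) : ℕ :=
  (Finset.univ.filter fun p : Fin P × Fin P =>
    ((p.2 : ℕ) = (p.1 : ℕ) + 1) ∧ x p.2 = x p.1 + 1).card

/-- Number of clusters `N_c(x) = P - nPairs x`. -/
def Nc {P : ℕ} (x : Fin P → ℤ) : ℕ := P - nPairs x

/-- The matrix `F(X,Y,t)` with entries `f(i-j, x_i - y_j, t)`. -/
def Fmat (v : ℝ) {P : ℕ} (x y : Fin P → ℤ) (t : ℕ) : Matrix (Fin P) (Fin P) ℝ :=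
  Matrix.of fun i j => f v ((i : ℤ) - (j : ℤ)) (x i - y j) t

/-- One-step transition probability of the parallel-update TASEP. -/
def Tstep (v : ℝ) {P : ℕ} (x x' : Fin P → ℤ) : ℝ :=
  ∏ i : Fin P,
    if x i = x' i + 1 ∧ (∀ j : Fin P, (j : ℕ) = (i : ℕ) + 1 → x' i + 1 < x' j) then v
    else if x i = x' i ∧ (∀ j : Fin P, (j : ℕ) = (i : ℕ) + 1 → x' i + 1 < x' j) then 1 - v
    else if x i = x' i ∧ (∃ j : Fin P, (j : ℕ) = (i : ℕ) + 1 ∧ x' j = x' i + 1) then 1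
    else 0

/-- Transformed transition probability `T₀(X,X') = (1-v)^(N_c(X)-N_c(X')) T(X,X')`. -/
def T0 (v : ℝ) {P : ℕ} (x x' : Fin P → ℤ) : ℝ :=
  (1 - v) ^ ((Nc x : ℤ) - (Nc x' : ℤ)) * Tstep v x x'

/-- `shiftBy x k` subtracts `1` from the coordinates selected by `k`. -/
def shiftBy {P : ℕ} (x : Fin P → ℤ) (k : Fin P → Bool) : Fin P → ℤ :=
  fun i => x i - if k i then 1 else 0

/-- `t`-step probability of the parallel-update TASEP started from `x0`. -/
def Pt (v : ℝ) {P : ℕ} (x0 : Fin P → ℤ) : ℕ → (Fin P → ℤ) → ℝ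
  | 0 => fun x => if x = x0 then 1 else 0
  | t + 1 => fun x => ∑ k : Fin P → Bool,
      if StrictMono (shiftBy x k) then
        Tstep v x (shiftBy x k) * Pt v x0 t (shiftBy x k)
      else 0

/-- One-particle weight `F₀(x|t)`. -/
def F0 (v : ℝ) (x : ℤ) (t : ℕ) : ℝ :=
  if 0 ≤ x ∧ x ≤ (t : ℤ) then (t.choose x.toNat : ℝ) * v ^ x.toNat * (1 - v) ^ (t - x.toNat)
  else 0

/-- Schütz's functions `F_m(N|t)` for the backward sequential update. -/
def Fm (v : ℝ) (m : ℤ) (N : ℤ) (t : ℕ) : ℝ :=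
  if 0 < m then
    ∑' k : ℕ, ((k + m.toNat - 1).choose (m.toNat - 1) : ℝ) * F0 v (N + (k : ℤ)) t
  else if m = 0 then F0 v N t
  else
    ∑ k ∈ Finset.range (m.natAbs + 1),
      (-1 : ℝ) ^ k * (m.natAbs.choose k : ℝ) * F0 v (N + (k : ℤ)) t

/-- The functions `F̃_m(N|t)` for the parallel update. -/
def Ftil (v : ℝ) (m : ℤ) (N : ℤ) (t : ℕ) : ℝ :=
  if 0 < m then
    ∑ n ∈ Finset.range (m.toNat + 1),
      ∑' k : ℤ, if -(n : ℤ) ≤ k then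
        (m.toNat.choose n : ℝ) * ((m + (n : ℤ) + k - 1).toNat.choose ((n : ℤ) + k).toNat : ℝ) *
          lam v ^ n * F0 v (N + k) t
      else 0
  else if m = 0 then F0 v N t
  else
    ∑ n ∈ Finset.range (m.natAbs + 1),
      ∑' k : ℤ, if -(n : ℤ) ≤ k then
        (-1 : ℝ) ^ n * (m.natAbs.choose n : ℝ) *
          (((m.natAbs : ℤ) + (n : ℤ) + k - 1).toNat.choose ((n : ℤ) + k).toNat : ℝ) *
          (-(lam v)) ^ ((n : ℤ) + k).toNat * F0 v (N - k) t
      else 0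

/-- One-step transition probability of the TASEP with backward sequential update. -/
def TBw (v : ℝ) {P : ℕ} (x x' : Fin P → ℤ) : ℝ :=
  ∏ i : Fin P,
    if h : (i : ℕ) + 1 < P then
      if x' i + 1 < x' ⟨(i : ℕ) + 1, h⟩ ∨
          (x' ⟨(i : ℕ) + 1, h⟩ = x' i + 1 ∧ x ⟨(i : ℕ) + 1, h⟩ = x' ⟨(i : ℕ) + 1, h⟩ + 1) then
        (if x i = x' i + 1 then v else if x i = x' i then 1 - v else 0)
      else if x' ⟨(i : ℕ) + 1, h⟩ = x' i + 1 ∧ x ⟨(i : ℕ) + 1, h⟩ = x' ⟨(i : ℕ) + 1, h⟩ then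
        (if x i = x' i then 1 else 0)
      else 0
    else
      (if x i = x' i + 1 then v else if x i = x' i then 1 - v else 0)

/-- `t`-step probability of the backward-sequential-update TASEP started from `x0`. -/
def Pbw (v : ℝ) {P : ℕ} (x0 : Fin P → ℤ) : ℕ → (Fin P → ℤ) → ℝ
  | 0 => fun x => if x = x0 then 1 else 0
  | t + 1 => fun x => ∑ k : Fin P → Bool,
      if StrictMono (shiftBy x k) then
        TBw v x (shiftBy x k) * Pbw v x0 t (shiftBy x k)
      else 0

/-- Reversed-negated configuration `ι(X)_i = -x_{P+1-i}`. -/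
def iota {P : ℕ} (x : Fin P → ℤ) : Fin P → ℤ := fun i => - x i.rev

/-- `i` is a cluster head of `x` (first particle of a cluster). -/
def isHead {P : ℕ} (x : Fin P → ℤ) (i : Fin P) : Prop :=
  ∀ j : Fin P, (i : ℕ) = (j : ℕ) + 1 → x j + 1 < x i

/-- Position of the `i`-th walker at time `s`, given steps `ε`. -/
def walkerPos {P t : ℕ} (x0 : Fin P → ℤ) (ε : Fin P → Fin t → Bool) (i : Fin P) (s : ℕ) : ℤ :=
  x0 i + ((Finset.univ.filter fun u : Fin t => (u : ℕ) < s ∧ ε i u = true).card : ℤ)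

/-- General Bethe-ansatz sum with amplitudes `A`. -/
def betheSum {P : ℕ} (z : Fin P → ℂ) (A : Equiv.Perm (Fin P) → ℂ) (x : Fin P → ℤ) : ℂ :=
  ∑ σ : Equiv.Perm (Fin P), A σ * ∏ i : Fin P, z (σ i) ^ (-(x i))

/-- `ξ(z) = -(1+λz)/(1-1/z)`. -/
def xiC (v : ℝ) (z : ℂ) : ℂ := -(1 + (lam v : ℂ) * z) / (1 - 1 / z)

/-- Bethe amplitudes `A_σ = sgn(σ) ∏ ξ_{σ(i)}^{i-σ(i)}`. -/
def ampA (v : ℝ) {P : ℕ} (z : Fin P → ℂ) (σ : Equiv.Perm (Fin P)) : ℂ :=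
  ((Equiv.Perm.sign σ : ℤ) : ℂ) * ∏ i : Fin P, xiC v (z (σ i)) ^ ((i : ℤ) - (σ i : ℤ))

/-- The Bethe eigenfunction `B(x)`. -/
def betheB (v : ℝ) {P : ℕ} (z : Fin P → ℂ) (x : Fin P → ℤ) : ℂ :=
  betheSum z (ampA v z) x


/-- Probability of a single step: `v` for a jump, `1 - v` for staying. -/
def stepWeight (v : ℝ) (b : Bool) : ℝ := if b then v else 1 - v

/-- Starting positions after a first step `k`. -/
def stepFrom {P : ℕ} (x0 : Fin P → ℤ) (k : Fin P → Bool) : Fin P → ℤ :=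
  fun i => x0 i + if k i then 1 else 0

lemma F0_zero (v : ℝ) (y : ℤ) : F0 v y 0 = if y = 0 then 1 else 0 := by
  unfold F0
  by_cases h : y = 0
  · simp [h]
  · rw [if_neg (by push_cast; omega), if_neg h]

lemma F0_natCast (v : ℝ) (n t : ℕ) : F0 v n t = t.choose n * v ^ n * (1 - v) ^ (t - n) := by
  unfold F0
  by_cases h : n ≤ t
  · rw [if_pos (by omega)]
    simp
  · rw [if_neg (by omega), Nat.choose_eq_zero_of_lt (by omega)]
    simp

lemma F0_of_neg (v : ℝ) {y : ℤ} (hy : y < 0) (t : ℕ) : F0 v y t = 0 :=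
  if_neg (by omega)

lemma F0_succ (v : ℝ) (y : ℤ) (t : ℕ) :
    F0 v y (t + 1) = v * F0 v (y - 1) t + (1 - v) * F0 v y t := by
  rcases lt_or_ge y 0 with hy | hy
  · simp [F0_of_neg v hy, F0_of_neg v (show y - 1 < 0 by omega)]
  lift y to ℕ using hy
  cases y with
  | zero =>
    rw [F0_of_neg v (show ((0 : ℕ) : ℤ) - 1 < 0 by decide), F0_natCast, F0_natCast]
    simp [pow_succ, mul_comm]
  | succ n =>
    rw [show ((n + 1 : ℕ) : ℤ) - 1 = (n : ℕ) by push_cast; ring, F0_natCast, F0_natCast,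
      F0_natCast, Nat.choose_succ_succ, Nat.add_sub_add_right]
    rcases lt_or_ge n t with h | h
    · rw [show t - n = t - (n + 1) + 1 by omega]
      push_cast
      ring
    · rw [Nat.choose_eq_zero_of_lt (show t < n + 1 by omega)]
      push_cast
      ring

lemma prod_stepWeight (v : ℝ) {t : ℕ} (e : Fin t → Bool) :
    v ^ (Finset.univ.filter fun u : Fin t => e u = true).card *
        (1 - v) ^ (t - (Finset.univ.filter fun u : Fin t => e u = true).card)
      = ∏ u, stepWeight v (e u) := by
  unfold stepWeight
  rw [Finset.prod_ite, Finset.prod_const, Finset.prod_const]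
  congr 2
  have h := Finset.card_filter_add_card_filter_not (s := Finset.univ) fun u : Fin t => e u = true
  rw [Finset.card_univ, Fintype.card_fin] at h
  omega

/-- Splitting off the first step of each walker. -/
def consStepEquiv (P t : ℕ) :
    (Fin P → Bool) × (Fin P → Fin t → Bool) ≃ (Fin P → Fin (t + 1) → Bool) where
  toFun p := fun i => Fin.cons (p.1 i) (p.2 i)
  invFun e := (fun i => e i 0, fun i u => e i u.succ)
  left_inv p := by simp
  right_inv e := by
    funext i
    exact Fin.cons_self_tail (e i)

lemma walkerPos_zero {P t : ℕ} (x0 : Fin P → ℤ) (ε : Fin P → Fin t → Bool) (i : Fin P) :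
    walkerPos x0 ε i 0 = x0 i := by
  simp [walkerPos]

lemma walkerPos_cons_succ {P t : ℕ} (x0 : Fin P → ℤ) (k : Fin P → Bool)
    (ε : Fin P → Fin t → Bool) (i : Fin P) (s : ℕ) :
    walkerPos x0 (consStepEquiv P t (k, ε)) i (s + 1) = walkerPos (stepFrom x0 k) ε i s := by
  have hzero : consStepEquiv P t (k, ε) i 0 = k i := rfl
  have hsucc (u : Fin t) : consStepEquiv P t (k, ε) i u.succ = ε i u := rfl
  simp only [walkerPos, stepFrom, Finset.card_filter]
  rw [Fin.sum_univ_succ]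
  simp [hzero, hsucc, add_assoc]

lemma monotone_stepFrom {P : ℕ} {x0 : Fin P → ℤ} (hx0 : StrictMono x0) (k : Fin P → Bool) :
    Monotone (stepFrom x0 k) := by
  intro i j hij
  rcases hij.eq_or_lt with rfl | hij
  · exact le_rfl
  have := hx0 hij
  simp only [stepFrom]
  split_ifs <;> omega

/-- The determinant `det [F₀(x_j - x⁰_i | t)]`. -/
def walkDet (v : ℝ) {P : ℕ} (t : ℕ) (x0 x : Fin P → ℤ) : ℝ :=
  (Matrix.of fun i j : Fin P => F0 v (x j - x0 i) t).det

lemma walkDet_succ (v : ℝ) {P : ℕ} (t : ℕ) (x0 x : Fin P → ℤ) :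
    walkDet v (t + 1) x0 x
      = ∑ k : Fin P → Bool, (∏ i, stepWeight v (k i)) * walkDet v t (stepFrom x0 k) x := by
  have hrow : (Matrix.of fun i j : Fin P => F0 v (x j - x0 i) (t + 1)) =
      fun i => ∑ b : Bool, stepWeight v b •
        fun j => F0 v (x j - (x0 i + if b then 1 else 0)) t := by
    funext i j
    simp [F0_succ, stepWeight, sub_add_eq_sub_sub]
  have hdet (M : Fin P → Fin P → ℝ) :
      Matrix.det M = (Matrix.detRowAlternating (R := ℝ) (n := Fin P)).toMultilinearMap M := rfl
  rw [walkDet, hrow, hdet, MultilinearMap.map_sum]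
  refine Finset.sum_congr rfl fun k _ => ?_
  rw [MultilinearMap.map_smul_univ, ← hdet]
  rfl

lemma walkDet_eq_zero_of_not_strictMono (v : ℝ) {P : ℕ} (t : ℕ) {y x : Fin P → ℤ}
    (hy : Monotone y) (hy' : ¬ StrictMono y) : walkDet v t y x = 0 := by
  have hinj : ¬ Function.Injective y := fun h => hy' (hy.strictMono_of_injective h)
  simp only [Function.Injective, not_forall] at hinj
  obtain ⟨i, j, hij, hne⟩ := hinj
  refine Matrix.det_zero_of_row_eq hne ?_
  funext l
  simp [hij]

lemma walkDet_zero (v : ℝ) {P : ℕ} {x0 x : Fin P → ℤ} (hx0 : StrictMono x0)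
    (hx : StrictMono x) : walkDet v 0 x0 x = if x0 = x then 1 else 0 := by
  unfold walkDet
  split_ifs with h
  · subst h
    rw [← Matrix.det_one (n := Fin P) (R := ℝ)]
    congr 1
    ext i j
    simp [F0_zero, Matrix.one_apply, sub_eq_zero, hx0.injective.eq_iff, eq_comm]
  · have hrow : ∃ i, ∀ j, x j ≠ x0 i := by
      by_contra! hall
      choose g hg using hall
      have hgi : Function.Injective g := fun a b hab => hx0.injective (by rw [← hg, ← hg, hab])
      have hgs := Finite.surjective_of_injective hgi
      refine h ((StrictMono.range_inj hx0 hx).1 ?_)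
      rw [show x0 = x ∘ g from funext fun i => (hg i).symm, hgs.range_comp]
    obtain ⟨i, hi⟩ := hrow
    refine Matrix.det_eq_zero_of_row_eq_zero i fun j => ?_
    simp [F0_zero, sub_eq_zero, hi j]

/-- The walks `ε` started from `x0` end in `x` and never meet. -/
def IsVicious {P t : ℕ} (x0 x : Fin P → ℤ) (ε : Fin P → Fin t → Bool) : Prop :=
  (∀ i, walkerPos x0 ε i t = x i) ∧
    ∀ s : ℕ, s ≤ t → StrictMono fun i => walkerPos x0 ε i s

lemma IsVicious.strictMono {P t : ℕ} {x0 x : Fin P → ℤ} {ε : Fin P → Fin t → Bool}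
    (h : IsVicious x0 x ε) : StrictMono x0 := by
  simpa only [walkerPos_zero] using h.2 0 (Nat.zero_le t)

lemma isVicious_cons_iff {P t : ℕ} {x0 : Fin P → ℤ} (hx0 : StrictMono x0) (x : Fin P → ℤ)
    (k : Fin P → Bool) (ε : Fin P → Fin t → Bool) :
    IsVicious x0 x (consStepEquiv P t (k, ε)) ↔ IsVicious (stepFrom x0 k) x ε := by
  unfold IsVicious
  simp only [walkerPos_cons_succ]
  refine and_congr_right fun _ => ⟨fun h s hs => ?_, fun h s hs => ?_⟩
  · simpa only [walkerPos_cons_succ] using h (s + 1) (by omega)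
  · cases s with
    | zero => simpa only [walkerPos_zero] using hx0
    | succ s => simpa only [walkerPos_cons_succ] using h s (by omega)

lemma sum_isVicious_eq_walkDet (v : ℝ) {P : ℕ} {x : Fin P → ℤ} (hx : StrictMono x) (t : ℕ) :
    ∀ {x0 : Fin P → ℤ}, StrictMono x0 →
      ∑ ε : Fin P → Fin t → Bool,
        (if IsVicious x0 x ε then ∏ i, ∏ u, stepWeight v (ε i u) else 0) = walkDet v t x0 x := by
  induction t with
  | zero =>
    intro x0 hx0
    rw [walkDet_zero v hx0 hx, Fintype.sum_unique]
    have h : IsVicious x0 x (default : Fin P → Fin 0 → Bool) ↔ x0 = x := by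
      simp [IsVicious, walkerPos_zero, hx0, funext_iff]
    simp only [Finset.univ_eq_empty, Finset.prod_empty, Finset.prod_const_one]
    exact if_congr h rfl rfl
  | succ t ih =>
    intro x0 hx0
    rw [walkDet_succ, ← (consStepEquiv P t).sum_comp, Fintype.sum_prod_type]
    refine Finset.sum_congr rfl fun k _ => ?_
    have hsum : ∑ ε : Fin P → Fin t → Bool,
        (if IsVicious (stepFrom x0 k) x ε then ∏ i, ∏ u, stepWeight v (ε i u) else 0)
          = walkDet v t (stepFrom x0 k) x := by
      by_cases hk : StrictMono (stepFrom x0 k)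
      · exact ih hk
      · rw [walkDet_eq_zero_of_not_strictMono v t (monotone_stepFrom hx0 k) hk]
        exact Finset.sum_eq_zero fun ε _ => if_neg fun h => hk h.strictMono
    rw [← hsum, Finset.mul_sum]
    refine Finset.sum_congr rfl fun ε _ => ?_
    simp only [isVicious_cons_iff hx0, mul_ite, mul_zero]
    congr 1
    rw [← Finset.prod_mul_distrib]
    refine Finset.prod_congr rfl fun i _ => ?_
    rw [Fin.prod_univ_succ]
    rfl

/-- Vicious walkers / Lindström–Gessel–Viennot: the weighted number of tuples of
non-intersecting walks equals `det [F₀(x_j - x⁰_i | t)]`. -/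
theorem vicious_walkers_determinant
    (v : ℝ) (hv0 : 0 < v) (hv1 : v < 1) (P : ℕ) (hP : 1 ≤ P) (t : ℕ)
    (x0 x : Fin P → ℤ) (hx0 : StrictMono x0) (hx : StrictMono x) :
    ∑ ε : Fin P → Fin t → Bool,
        (if (∀ i, walkerPos x0 ε i t = x i) ∧
            (∀ s : ℕ, s ≤ t → StrictMono fun i => walkerPos x0 ε i s) then
          ∏ i : Fin P,
            v ^ (Finset.univ.filter fun u : Fin t => ε i u = true).card *
              (1 - v) ^ (t - (Finset.univ.filter fun u : Fin t => ε i u = true).card)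
        else 0)
      = (Matrix.of fun i j : Fin P => F0 v (x j - x0 i) t).det := by
  simp only [prod_stepWeight]
  rw [← walkDet, ← sum_isVicious_eq_walkDet v hx t hx0]
  exact Finset.sum_congr rfl fun ε _ => if_congr Iff.rfl rfl rfl

end

end TASEP
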